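/- Let G be a finite simple graph and let B = V(G) \ (α_core(G) ∪ τ_core(G)). Then the induced subgraph G[B] has no isolated vertices, G[B] is a B-graph (every vertex of G[B] belongs to a maximum stable set of G[B]), and G[B] is τ-critical (removing any vertex of G[B] strictly decreases its vertex covering number). -/

import Mathlib

/-- A set of vertices is stable (independent) if no two of its vertices are adjacent. -/
def IsStable {V : Type*} (G : SimpleGraph V) (S : Set V) : Prop :=
  ∀ ⦃u⦄, u ∈ S → ∀ ⦃v⦄, v ∈ S → ¬ G.Adj u v

/-- A set of vertices is a vertex cover if it meets every edge. -/
def IsCover {V : Type*} (G : SimpleGraph V) (C : Set V) : Prop :=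
  ∀ ⦃u v⦄, G.Adj u v → u ∈ C ∨ v ∈ C

/-- The stability number α(G): the maximum size of a stable set. -/
noncomputable def alphaNum {V : Type*} (G : SimpleGraph V) : ℕ :=
  sSup {n | ∃ S : Set V, IsStable G S ∧ S.ncard = n}

/-- The vertex covering number τ(G): the minimum size of a vertex cover. -/
noncomputable def tauNum {V : Type*} (G : SimpleGraph V) : ℕ :=
  sInf {n | ∃ C : Set V, IsCover G C ∧ C.ncard = n}

/-- An inclusionwise maximal stable set. -/
def IsMaximalStable {V : Type*} (G : SimpleGraph V) (S : Set V) : Prop :=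
  IsStable G S ∧ ∀ T : Set V, IsStable G T → S ⊆ T → S = T

/-- The σ_v-cover number: the maximum m such that every vertex belongs to a
maximal stable set with at least m vertices. -/
noncomputable def sigmaV {V : Type*} (G : SimpleGraph V) : ℕ :=
  sSup {m | ∀ v : V, ∃ S : Set V, v ∈ S ∧ IsMaximalStable G S ∧ m ≤ S.ncard}

/-- α_core(G): the intersection of all maximum stable sets of G. -/
def alphaCore {V : Type*} (G : SimpleGraph V) : Set V :=
  {v | ∀ S : Set V, IsStable G S → S.ncard = alphaNum G → v ∈ S}

/-- τ_core(G): the intersection of all minimum vertex covers of G. -/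
def tauCore {V : Type*} (G : SimpleGraph V) : Set V :=
  {v | ∀ C : Set V, IsCover G C → C.ncard = tauNum G → v ∈ C}

section StableSets

variable {V : Type*}

theorem IsStable.isCover_compl {G : SimpleGraph V} {S : Set V} (hS : IsStable G S) :
    IsCover G Sᶜ := by
  intro u v huv
  by_contra! h
  exact hS (not_not.mp h.1) (not_not.mp h.2) huv

theorem IsCover.isStable_compl {G : SimpleGraph V} {C : Set V} (hC : IsCover G C) :
    IsStable G Cᶜ := fun _ hu _ hv huv ↦ (hC huv).elim hu hv

theorem IsCover.tauNum_le {G : SimpleGraph V} {C : Set V} (hC : IsCover G C) :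
    tauNum G ≤ C.ncard := Nat.sInf_le ⟨C, hC, rfl⟩

theorem exists_isCover_ncard_eq_tauNum (G : SimpleGraph V) :
    ∃ C : Set V, IsCover G C ∧ C.ncard = tauNum G :=
  Nat.sInf_mem (s := {n | ∃ C : Set V, IsCover G C ∧ C.ncard = n})
    ⟨_, Set.univ, fun _ _ _ ↦ Or.inl trivial, rfl⟩

variable [Finite V]

theorem bddAbove_ncard_isStable (G : SimpleGraph V) :
    BddAbove {n | ∃ S : Set V, IsStable G S ∧ S.ncard = n} := by
  refine ⟨Nat.card V, ?_⟩
  rintro n ⟨S, -, rfl⟩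
  exact Set.ncard_le_card S

theorem IsStable.ncard_le_alphaNum {G : SimpleGraph V} {S : Set V} (hS : IsStable G S) :
    S.ncard ≤ alphaNum G := le_csSup (bddAbove_ncard_isStable G) ⟨S, hS, rfl⟩

theorem exists_isStable_ncard_eq_alphaNum (G : SimpleGraph V) :
    ∃ S : Set V, IsStable G S ∧ S.ncard = alphaNum G :=
  Nat.sSup_mem (s := {n | ∃ S : Set V, IsStable G S ∧ S.ncard = n})
    ⟨_, ∅, fun _ h ↦ h.elim, rfl⟩ (bddAbove_ncard_isStable G)

/-- Gallai's identity. -/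
theorem alphaNum_add_tauNum (G : SimpleGraph V) : alphaNum G + tauNum G = Nat.card V := by
  obtain ⟨S, hS, hSα⟩ := exists_isStable_ncard_eq_alphaNum G
  obtain ⟨C, hC, hCτ⟩ := exists_isCover_ncard_eq_tauNum G
  have h₁ := hS.isCover_compl.tauNum_le
  have h₂ := hC.isStable_compl.ncard_le_alphaNum
  have h₃ := Set.ncard_add_ncard_compl S
  have h₄ := Set.ncard_add_ncard_compl C
  omega

theorem ncard_compl_eq_tauNum {G : SimpleGraph V} {S : Set V}
    (hSα : S.ncard = alphaNum G) : Sᶜ.ncard = tauNum G := by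
  have h₁ := alphaNum_add_tauNum G
  have h₂ := Set.ncard_add_ncard_compl S
  omega

theorem mem_tauCore_iff {G : SimpleGraph V} {v : V} :
    v ∈ tauCore G ↔ ∀ S : Set V, IsStable G S → S.ncard = alphaNum G → v ∉ S := by
  refine ⟨fun h S hS hSα ↦ h Sᶜ hS.isCover_compl (ncard_compl_eq_tauNum hSα),
    fun h C hC hCτ ↦ not_not.mp (h Cᶜ hC.isStable_compl ?_)⟩
  have h₁ := alphaNum_add_tauNum G
  have h₂ := Set.ncard_add_ncard_compl C
  omega

theorem mem_tauCore_of_adj_mem_alphaCore {G : SimpleGraph V} {u v : V} (hu : u ∈ alphaCore G)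
    (huv : G.Adj u v) : v ∈ tauCore G :=
  mem_tauCore_iff.mpr fun S hS hSα hv ↦ hS (hu S hS hSα) hv huv

theorem exists_adj_of_notMem_of_ncard_eq_alphaNum {G : SimpleGraph V} {S : Set V} {v : V}
    (hS : IsStable G S) (hSα : S.ncard = alphaNum G) (hv : v ∉ S) : ∃ w ∈ S, G.Adj v w := by
  by_contra! h
  have hins : IsStable G (insert v S) := by
    rintro a (rfl | ha) b (rfl | hb) hab
    · exact G.irrefl hab
    · exact h b hb hab
    · exact h a ha hab.symm
    · exact hS ha hb hab
  have := hins.ncard_le_alphaNum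
  rw [Set.ncard_insert_of_notMem hv] at this
  omega

/-- A maximum stable set restricts to a maximum stable set of the subgraph induced outside the
two cores. -/
theorem ncard_preimage_eq_alphaNum_induce {G : SimpleGraph V} {S : Set V}
    (hS : IsStable G S) (hSα : S.ncard = alphaNum G) :
    ((↑) ⁻¹' S : Set ↥(alphaCore G ∪ tauCore G)ᶜ).ncard =
      alphaNum (G.induce (alphaCore G ∪ tauCore G)ᶜ) := by
  set B := (alphaCore G ∪ tauCore G)ᶜ with hB
  have hpre : IsStable (G.induce B) ((↑) ⁻¹' S) := fun _ hu _ hv huv ↦ hS hu hv huv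
  refine le_antisymm hpre.ncard_le_alphaNum ?_
  obtain ⟨T, hT, hTα⟩ := exists_isStable_ncard_eq_alphaNum (G.induce B)
  have hA : alphaCore G ⊆ S := fun v hv ↦ hv S hS hSα
  have hSsub : S ⊆ alphaCore G ∪ Subtype.val '' ((↑) ⁻¹' S : Set B) := by
    intro v hv
    by_cases hvA : v ∈ alphaCore G
    · exact Or.inl hvA
    · have hvB : v ∈ B := by
        rintro (h | h)
        · exact hvA h
        · exact mem_tauCore_iff.mp h S hS hSα hv
      exact Or.inr ⟨⟨v, hvB⟩, hv, rfl⟩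
  have hnadj : ∀ u ∈ alphaCore G, ∀ w : B, ¬ G.Adj u w := fun u hu w huw ↦
    w.2 (Or.inr (mem_tauCore_of_adj_mem_alphaCore hu huw))
  have hAT : IsStable G (alphaCore G ∪ Subtype.val '' T) := by
    rintro a (ha | ⟨a, ha, rfl⟩) b (hb | ⟨b, hb, rfl⟩) hab
    · exact hS (hA ha) (hA hb) hab
    · exact hnadj _ ha b hab
    · exact hnadj _ hb a hab.symm
    · exact hT ha hb hab
  have hdisj : Disjoint (alphaCore G) (Subtype.val '' T) := by
    rw [Set.disjoint_left]
    rintro _ hx ⟨y, -, rfl⟩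
    exact y.2 (Or.inl hx)
  have h₁ := hAT.ncard_le_alphaNum
  have h₂ := (Set.ncard_le_ncard hSsub).trans (Set.ncard_union_le _ _)
  rw [Set.ncard_union_eq hdisj, Set.ncard_image_of_injective _ Subtype.val_injective] at h₁
  rw [Set.ncard_image_of_injective _ Subtype.val_injective] at h₂
  omega

theorem tauNum_induce_ne_lt {G : SimpleGraph V} {S : Set V} {v : V}
    (hS : IsStable G S) (hSα : S.ncard = alphaNum G) (hv : v ∉ S) :
    tauNum (G.induce {u | u ≠ v}) < tauNum G := by
  have hcov : IsCover (G.induce {u | u ≠ v}) ((↑) ⁻¹' Sᶜ) :=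
    fun a b hab ↦ hS.isCover_compl (u := (a : V)) (v := b) hab
  calc tauNum (G.induce {u | u ≠ v})
      ≤ ((↑) ⁻¹' Sᶜ : Set {u | u ≠ v}).ncard := hcov.tauNum_le
    _ = (Subtype.val '' ((↑) ⁻¹' Sᶜ : Set {u | u ≠ v})).ncard :=
        (Set.ncard_image_of_injective _ Subtype.val_injective).symm
    _ < Sᶜ.ncard := by
        refine Set.ncard_lt_ncard ⟨Set.image_preimage_subset _ _, fun h ↦ ?_⟩
        obtain ⟨x, -, hx⟩ := h hv
        exact x.2 hx
    _ = tauNum G := ncard_compl_eq_tauNum hSα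

end StableSets

/-- Let B = V(G) \ (α_core(G) ∪ τ_core(G)).  Then G[B] has no isolated
vertices, G[B] is a B-graph (every vertex belongs to a maximum stable set
of G[B]), and G[B] is τ-critical (removing any vertex strictly decreases
the vertex covering number). -/
theorem stmt_4 {V : Type*} [Fintype V] (G : SimpleGraph V)
    (B : Set V) (hB : B = (alphaCore G ∪ tauCore G)ᶜ) :
    (∀ v : B, ∃ w : B, (G.induce B).Adj v w) ∧
    (∀ v : B, ∃ S : Set B, IsStable (G.induce B) S ∧
      S.ncard = alphaNum (G.induce B) ∧ v ∈ S) ∧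
    (∀ v : B, tauNum ((G.induce B).induce {u | u ≠ v}) < tauNum (G.induce B)) := by
  subst hB
  refine ⟨fun v ↦ ?_, fun v ↦ ?_, fun v ↦ ?_⟩
  · have hv : (v : V) ∉ alphaCore G := fun h ↦ v.2 (Or.inl h)
    simp only [alphaCore, Set.mem_ofPred_eq, not_forall] at hv
    obtain ⟨S, hS, hSα, hvS⟩ := hv
    obtain ⟨w, hw, hvw⟩ := exists_adj_of_notMem_of_ncard_eq_alphaNum hS hSα hvS
    refine ⟨⟨w, ?_⟩, hvw⟩
    rintro (h | h)
    · exact v.2 (Or.inr (mem_tauCore_of_adj_mem_alphaCore h hvw.symm))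
    · exact mem_tauCore_iff.mp h S hS hSα hw
  · have hv : (v : V) ∉ tauCore G := fun h ↦ v.2 (Or.inr h)
    rw [mem_tauCore_iff] at hv
    push Not at hv
    obtain ⟨S, hS, hSα, hvS⟩ := hv
    exact ⟨Subtype.val ⁻¹' S, fun _ ha _ hb hab ↦ hS ha hb hab,
      ncard_preimage_eq_alphaNum_induce hS hSα, hvS⟩
  · have hv : (v : V) ∉ alphaCore G := fun h ↦ v.2 (Or.inl h)
    simp only [alphaCore, Set.mem_ofPred_eq, not_forall] at hv
    obtain ⟨S, hS, hSα, hvS⟩ := hv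
    exact tauNum_induce_ne_lt (S := Subtype.val ⁻¹' S) (fun _ ha _ hb hab ↦ hS ha hb hab)
      (ncard_preimage_eq_alphaNum_induce hS hSα) hvS
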